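/- Let (H, μ, Δ, α_H) be a Hom-bialgebra with α_H bijective, and let (M, α_M) and (N, α_N) be Yetter-Drinfeld modules over H. Then (M⊗N, α_M⊗α_N), equipped with the action h·(m⊗n) = h₁·m ⊗ h₂·n and the coaction m⊗n ↦ α_H^{-2}(m_{(-1)}n_{(-1)}) ⊗ (m_{(0)}⊗n_{(0)}), is a Yetter-Drinfeld module over H (denoted M⊗̂N); in particular it is a left H-module, a left H-comodule, and satisfies the Yetter-Drinfeld compatibility condition. -/

import Mathlib

open TensorProduct

noncomputable section

namespace HomYD

variable (k : Type*) [Field k]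
variable {H M N : Type*}
variable [AddCommGroup H] [Module k H]
variable [AddCommGroup M] [Module k M]
variable [AddCommGroup N] [Module k N]

/-- Rearrangement `(a ⊗ b) ⊗ c ↦ (a ⊗ c) ⊗ b`. -/
def rearr (A B C : Type*) [AddCommGroup A] [Module k A] [AddCommGroup B] [Module k B]
    [AddCommGroup C] [Module k C] :
    (A ⊗[k] B) ⊗[k] C →ₗ[k] (A ⊗[k] C) ⊗[k] B :=
  (TensorProduct.assoc k A C B).symm.toLinearMap ∘ₗ
    (TensorProduct.map LinearMap.id (TensorProduct.comm k B C).toLinearMap) ∘ₗ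
      (TensorProduct.assoc k A B C).toLinearMap

/-- Middle-four exchange `(a ⊗ b) ⊗ (c ⊗ d) ↦ (a ⊗ c) ⊗ (b ⊗ d)`. -/
def ttc (A B C D : Type*) [AddCommGroup A] [Module k A] [AddCommGroup B] [Module k B]
    [AddCommGroup C] [Module k C] [AddCommGroup D] [Module k D] :
    (A ⊗[k] B) ⊗[k] (C ⊗[k] D) →ₗ[k] (A ⊗[k] C) ⊗[k] (B ⊗[k] D) :=
  (TensorProduct.tensorTensorTensorComm k A B C D).toLinearMap

/-- Hom-bialgebra (no unit/counit): multiplicativity of `α`, Hom-associativity,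
comultiplicativity of `α`, Hom-coassociativity, and `Δ` multiplicative. -/
structure IsHomBialgebra (μ : H ⊗[k] H →ₗ[k] H) (Δ : H →ₗ[k] H ⊗[k] H)
    (α : H →ₗ[k] H) : Prop where
  mul_mult : ∀ a b : H, α (μ (a ⊗ₜ[k] b)) = μ (α a ⊗ₜ[k] α b)
  hom_assoc : ∀ a b c : H, μ (α a ⊗ₜ[k] μ (b ⊗ₜ[k] c)) = μ (μ (a ⊗ₜ[k] b) ⊗ₜ[k] α c)
  comul_compat : TensorProduct.map α α ∘ₗ Δ = Δ ∘ₗ α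
  hom_coassoc : (TensorProduct.assoc k H H H).toLinearMap ∘ₗ TensorProduct.map Δ α ∘ₗ Δ
      = TensorProduct.map α Δ ∘ₗ Δ
  comul_mul : Δ ∘ₗ μ
      = TensorProduct.map μ μ ∘ₗ ttc k H H H H ∘ₗ TensorProduct.map Δ Δ

/-- Left module over a Hom-(bi)algebra. -/
structure IsHomModule (μ : H ⊗[k] H →ₗ[k] H) (α : H →ₗ[k] H)
    (ρ : H ⊗[k] M →ₗ[k] M) (αM : M →ₗ[k] M) : Prop where
  str_compat : ∀ (h : H) (m : M), αM (ρ (h ⊗ₜ[k] m)) = ρ (α h ⊗ₜ[k] αM m)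
  hom_smul : ∀ (h h' : H) (m : M),
      ρ (α h ⊗ₜ[k] ρ (h' ⊗ₜ[k] m)) = ρ (μ (h ⊗ₜ[k] h') ⊗ₜ[k] αM m)

/-- Left comodule over a Hom-(bi)algebra. -/
structure IsHomComodule (Δ : H →ₗ[k] H ⊗[k] H) (α : H →ₗ[k] H)
    (lM : M →ₗ[k] H ⊗[k] M) (αM : M →ₗ[k] M) : Prop where
  str_compat : TensorProduct.map α αM ∘ₗ lM = lM ∘ₗ αM
  hom_coact : TensorProduct.map Δ αM ∘ₗ lM
      = (TensorProduct.assoc k H H M).symm.toLinearMap ∘ₗ TensorProduct.map α lM ∘ₗ lM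

/-- `h ⊗ m ↦ (h₁·m)₍₋₁₎ β(h₂) ⊗ (h₁·m)₍₀₎`. -/
def ydL (μ : H ⊗[k] H →ₗ[k] H) (Δ : H →ₗ[k] H ⊗[k] H) (β : H →ₗ[k] H)
    (ρ : H ⊗[k] M →ₗ[k] M) (lM : M →ₗ[k] H ⊗[k] M) : H ⊗[k] M →ₗ[k] H ⊗[k] M :=
  TensorProduct.map μ LinearMap.id ∘ₗ rearr k H M H ∘ₗ
    TensorProduct.map (lM ∘ₗ ρ) β ∘ₗ rearr k H H M ∘ₗ
      TensorProduct.map Δ LinearMap.id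

/-- `h ⊗ m ↦ β(h₁) γ(m₍₋₁₎) ⊗ γ(h₂)·m₍₀₎`. -/
def ydR (μ : H ⊗[k] H →ₗ[k] H) (Δ : H →ₗ[k] H ⊗[k] H) (β γ : H →ₗ[k] H)
    (ρ : H ⊗[k] M →ₗ[k] M) (lM : M →ₗ[k] H ⊗[k] M) : H ⊗[k] M →ₗ[k] H ⊗[k] M :=
  TensorProduct.map (μ ∘ₗ TensorProduct.map β γ) (ρ ∘ₗ TensorProduct.map γ LinearMap.id) ∘ₗ
    ttc k H H H M ∘ₗ TensorProduct.map Δ lM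

/-- Yetter-Drinfeld module over a Hom-bialgebra: Hom-module, Hom-comodule and the
compatibility `(h₁·m)₍₋₁₎ α²(h₂) ⊗ (h₁·m)₍₀₎ = α²(h₁) α(m₍₋₁₎) ⊗ α(h₂)·m₍₀₎`. -/
def IsYetterDrinfeld (μ : H ⊗[k] H →ₗ[k] H) (Δ : H →ₗ[k] H ⊗[k] H) (α : H →ₗ[k] H)
    (ρ : H ⊗[k] M →ₗ[k] M) (lM : M →ₗ[k] H ⊗[k] M) (αM : M →ₗ[k] M) : Prop :=
  IsHomModule k μ α ρ αM ∧ IsHomComodule k Δ α lM αM ∧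
    ydL k μ Δ (α ∘ₗ α) ρ lM = ydR k μ Δ (α ∘ₗ α) α ρ lM

/-- `m ⊗ n ↦ αHinv(m₍₋₁₎)·n ⊗ m₍₀₎`. -/
def Bmap (αHinv : H →ₗ[k] H) (lM : M →ₗ[k] H ⊗[k] M) (ρN : H ⊗[k] N →ₗ[k] N) :
    M ⊗[k] N →ₗ[k] N ⊗[k] M :=
  TensorProduct.map (ρN ∘ₗ TensorProduct.map αHinv LinearMap.id) LinearMap.id ∘ₗ
    rearr k H M N ∘ₗ TensorProduct.map lM LinearMap.id

/-- Quasi-braiding `m ⊗ n ↦ αN⁻¹(αH⁻¹(m₍₋₁₎)·n) ⊗ αM⁻¹(m₍₀₎)`. -/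
def braidYD (αH : H ≃ₗ[k] H) (αM : M ≃ₗ[k] M) (αN : N ≃ₗ[k] N)
    (lM : M →ₗ[k] H ⊗[k] M) (ρN : H ⊗[k] N →ₗ[k] N) : M ⊗[k] N →ₗ[k] N ⊗[k] M :=
  TensorProduct.map
      (αN.symm.toLinearMap ∘ₗ ρN ∘ₗ TensorProduct.map αH.symm.toLinearMap LinearMap.id)
      αM.symm.toLinearMap ∘ₗ rearr k H M N ∘ₗ TensorProduct.map lM LinearMap.id

/-- Action on `M ⊗ N`: `h ⊗ (m ⊗ n) ↦ h₁·m ⊗ h₂·n`. -/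
def hatAction (Δ : H →ₗ[k] H ⊗[k] H)
    (ρM : H ⊗[k] M →ₗ[k] M) (ρN : H ⊗[k] N →ₗ[k] N) :
    H ⊗[k] (M ⊗[k] N) →ₗ[k] M ⊗[k] N :=
  TensorProduct.map ρM ρN ∘ₗ ttc k H H M N ∘ₗ TensorProduct.map Δ LinearMap.id

/-- Coaction on `M ⊗ N`: `m ⊗ n ↦ αHinv²(m₍₋₁₎ n₍₋₁₎) ⊗ (m₍₀₎ ⊗ n₍₀₎)`. -/
def hatCoaction (μ : H ⊗[k] H →ₗ[k] H) (αHinv : H →ₗ[k] H)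
    (lM : M →ₗ[k] H ⊗[k] M) (lN : N →ₗ[k] H ⊗[k] N) :
    M ⊗[k] N →ₗ[k] H ⊗[k] (M ⊗[k] N) :=
  TensorProduct.map (αHinv ∘ₗ αHinv ∘ₗ μ) LinearMap.id ∘ₗ ttc k H M H N ∘ₗ
    TensorProduct.map lM lN

/-- Action on `M ⊗ N`: `h ⊗ (m ⊗ n) ↦ αHinv²(h₁)·m ⊗ αHinv²(h₂)·n`. -/
def tildeAction (Δ : H →ₗ[k] H ⊗[k] H) (αHinv : H →ₗ[k] H)
    (ρM : H ⊗[k] M →ₗ[k] M) (ρN : H ⊗[k] N →ₗ[k] N) :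
    H ⊗[k] (M ⊗[k] N) →ₗ[k] M ⊗[k] N :=
  TensorProduct.map ρM ρN ∘ₗ ttc k H H M N ∘ₗ
    TensorProduct.map
      (TensorProduct.map (αHinv ∘ₗ αHinv) (αHinv ∘ₗ αHinv) ∘ₗ Δ) LinearMap.id

/-- Coaction on `M ⊗ N`: `m ⊗ n ↦ m₍₋₁₎ n₍₋₁₎ ⊗ (m₍₀₎ ⊗ n₍₀₎)`. -/
def tildeCoaction (μ : H ⊗[k] H →ₗ[k] H)
    (lM : M →ₗ[k] H ⊗[k] M) (lN : N →ₗ[k] H ⊗[k] N) :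
    M ⊗[k] N →ₗ[k] H ⊗[k] (M ⊗[k] N) :=
  TensorProduct.map μ LinearMap.id ∘ₗ ttc k H M H N ∘ₗ TensorProduct.map lM lN

/-- Associator `(x ⊗ y) ⊗ z ↦ αX⁻¹(x) ⊗ (y ⊗ αZ(z))`. -/
def aYD {X Z : Type*} [AddCommGroup X] [Module k X] [AddCommGroup Z] [Module k Z]
    (αX : X ≃ₗ[k] X) (Y : Type*) [AddCommGroup Y] [Module k Y] (αZ : Z ≃ₗ[k] Z) :
    (X ⊗[k] Y) ⊗[k] Z →ₗ[k] X ⊗[k] (Y ⊗[k] Z) :=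
  (TensorProduct.assoc k X Y Z).toLinearMap ∘ₗ
    TensorProduct.map (TensorProduct.map αX.symm.toLinearMap LinearMap.id) αZ.toLinearMap

/-- Inverse associator `x ⊗ (y ⊗ z) ↦ (αX(x) ⊗ y) ⊗ αZ⁻¹(z)`. -/
def aYDinv {X Z : Type*} [AddCommGroup X] [Module k X] [AddCommGroup Z] [Module k Z]
    (αX : X ≃ₗ[k] X) (Y : Type*) [AddCommGroup Y] [Module k Y] (αZ : Z ≃ₗ[k] Z) :
    X ⊗[k] (Y ⊗[k] Z) →ₗ[k] (X ⊗[k] Y) ⊗[k] Z :=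
  TensorProduct.map (TensorProduct.map αX.toLinearMap LinearMap.id) αZ.symm.toLinearMap ∘ₗ
    (TensorProduct.assoc k X Y Z).symm.toLinearMap

/-- Associator `(x ⊗ y) ⊗ z ↦ αX(x) ⊗ (y ⊗ αZ⁻¹(z))`. -/
def aTilde {X Z : Type*} [AddCommGroup X] [Module k X] [AddCommGroup Z] [Module k Z]
    (αX : X ≃ₗ[k] X) (Y : Type*) [AddCommGroup Y] [Module k Y] (αZ : Z ≃ₗ[k] Z) :
    (X ⊗[k] Y) ⊗[k] Z →ₗ[k] X ⊗[k] (Y ⊗[k] Z) :=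
  (TensorProduct.assoc k X Y Z).toLinearMap ∘ₗ
    TensorProduct.map (TensorProduct.map αX.toLinearMap LinearMap.id) αZ.symm.toLinearMap

/-- Inverse associator `x ⊗ (y ⊗ z) ↦ (αX⁻¹(x) ⊗ y) ⊗ αZ(z)`. -/
def aTildeInv {X Z : Type*} [AddCommGroup X] [Module k X] [AddCommGroup Z] [Module k Z]
    (αX : X ≃ₗ[k] X) (Y : Type*) [AddCommGroup Y] [Module k Y] (αZ : Z ≃ₗ[k] Z) :
    X ⊗[k] (Y ⊗[k] Z) →ₗ[k] (X ⊗[k] Y) ⊗[k] Z :=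
  TensorProduct.map (TensorProduct.map αX.symm.toLinearMap LinearMap.id) αZ.toLinearMap ∘ₗ
    (TensorProduct.assoc k X Y Z).symm.toLinearMap

/-- Quasitriangular Hom-bialgebra. -/
def IsQuasitriangular (μ : H ⊗[k] H →ₗ[k] H) (Δ : H →ₗ[k] H ⊗[k] H) (α : H →ₗ[k] H)
    (R : H ⊗[k] H) : Prop :=
  IsHomBialgebra k μ Δ α ∧
  TensorProduct.map Δ α R
    = TensorProduct.map (TensorProduct.map α α) μ (ttc k H H H H (R ⊗ₜ[k] R)) ∧
  TensorProduct.map α Δ R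
    = TensorProduct.map μ (TensorProduct.map α α ∘ₗ (TensorProduct.comm k H H).toLinearMap)
        (ttc k H H H H (R ⊗ₜ[k] R)) ∧
  ∀ h : H, TensorProduct.map μ μ (ttc k H H H H ((TensorProduct.comm k H H (Δ h)) ⊗ₜ[k] R))
      = TensorProduct.map μ μ (ttc k H H H H (R ⊗ₜ[k] Δ h))

/-- Coaction induced by an R-matrix: `m ↦ α(R²) ⊗ R¹·m`. -/
def coactionFromR (R : H ⊗[k] H) (α : H →ₗ[k] H) (ρM : H ⊗[k] M →ₗ[k] M) :
    M →ₗ[k] H ⊗[k] M :=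
  (TensorProduct.comm k M H).toLinearMap ∘ₗ TensorProduct.map ρM α ∘ₗ rearr k H H M ∘ₗ
    TensorProduct.mk k (H ⊗[k] H) M R

/-- Quasi-braiding from an R-matrix: `m ⊗ n ↦ αN⁻¹(R²·n) ⊗ αM⁻¹(R¹·m)`. -/
def braidR (R : H ⊗[k] H) (ρM : H ⊗[k] M →ₗ[k] M) (ρN : H ⊗[k] N →ₗ[k] N)
    (αM : M ≃ₗ[k] M) (αN : N ≃ₗ[k] N) : M ⊗[k] N →ₗ[k] N ⊗[k] M :=
  TensorProduct.map αN.symm.toLinearMap αM.symm.toLinearMap ∘ₗ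
    (TensorProduct.comm k M N).toLinearMap ∘ₗ TensorProduct.map ρM ρN ∘ₗ
      ttc k H H M N ∘ₗ TensorProduct.mk k (H ⊗[k] H) (M ⊗[k] N) R

/-- Coquasitriangular Hom-bialgebra. -/
def IsCoquasitriangular (μ : H ⊗[k] H →ₗ[k] H) (Δ : H →ₗ[k] H ⊗[k] H) (α : H →ₗ[k] H)
    (σ : H ⊗[k] H →ₗ[k] k) : Prop :=
  IsHomBialgebra k μ Δ α ∧
  (∀ x y z : H, σ (μ (x ⊗ₜ[k] y) ⊗ₜ[k] α z)
      = LinearMap.mul' k k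
          (TensorProduct.map σ σ (ttc k H H H H ((α x ⊗ₜ[k] α y) ⊗ₜ[k] Δ z)))) ∧
  (∀ x y z : H, σ (α x ⊗ₜ[k] μ (y ⊗ₜ[k] z))
      = LinearMap.mul' k k
          (TensorProduct.map σ σ (ttc k H H H H (Δ x ⊗ₜ[k] (α z ⊗ₜ[k] α y))))) ∧
  (∀ x y : H,
      (TensorProduct.rid k H)
        (TensorProduct.map (μ ∘ₗ (TensorProduct.comm k H H).toLinearMap) σ
          (ttc k H H H H (Δ x ⊗ₜ[k] Δ y)))
      = (TensorProduct.lid k H)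
          (TensorProduct.map σ μ (ttc k H H H H (Δ x ⊗ₜ[k] Δ y))))

/-- Action induced by a coquasitriangular form: `h ⊗ m ↦ σ(m₍₋₁₎ ⊗ α(h)) • m₍₀₎`. -/
def actionFromSigma (σ : H ⊗[k] H →ₗ[k] k) (α : H →ₗ[k] H)
    (lM : M →ₗ[k] H ⊗[k] M) : H ⊗[k] M →ₗ[k] M :=
  (TensorProduct.lid k M).toLinearMap ∘ₗ
    TensorProduct.map (σ ∘ₗ TensorProduct.map LinearMap.id α ∘ₗ
        (TensorProduct.comm k H H).toLinearMap) LinearMap.id ∘ₗ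
      (TensorProduct.assoc k H H M).symm.toLinearMap ∘ₗ
        TensorProduct.map LinearMap.id lM

/-- Quasi-braiding from a coquasitriangular form:
`m ⊗ n ↦ σ(n₍₋₁₎ ⊗ m₍₋₁₎) • (αN⁻¹(n₍₀₎) ⊗ αM⁻¹(m₍₀₎))`. -/
def braidSigma (σ : H ⊗[k] H →ₗ[k] k)
    (lM : M →ₗ[k] H ⊗[k] M) (lN : N →ₗ[k] H ⊗[k] N)
    (αM : M ≃ₗ[k] M) (αN : N ≃ₗ[k] N) : M ⊗[k] N →ₗ[k] N ⊗[k] M :=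
  (TensorProduct.lid k (N ⊗[k] M)).toLinearMap ∘ₗ
    TensorProduct.map (σ ∘ₗ (TensorProduct.comm k H H).toLinearMap)
      (TensorProduct.map αN.symm.toLinearMap αM.symm.toLinearMap ∘ₗ
        (TensorProduct.comm k M N).toLinearMap) ∘ₗ
      ttc k H M H N ∘ₗ TensorProduct.map lM lN

@[simp]
theorem rearr_tmul {A B C : Type*} [AddCommGroup A] [Module k A] [AddCommGroup B] [Module k B]
    [AddCommGroup C] [Module k C] (a : A) (b : B) (c : C) :
    rearr k A B C ((a ⊗ₜ[k] b) ⊗ₜ[k] c) = (a ⊗ₜ[k] c) ⊗ₜ[k] b := by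
  simp [rearr]

@[simp]
theorem ttc_tmul {A B C D : Type*} [AddCommGroup A] [Module k A] [AddCommGroup B] [Module k B]
    [AddCommGroup C] [Module k C] [AddCommGroup D] [Module k D] (a : A) (b : B) (c : C) (d : D) :
    ttc k A B C D ((a ⊗ₜ[k] b) ⊗ₜ[k] (c ⊗ₜ[k] d)) = (a ⊗ₜ[k] c) ⊗ₜ[k] (b ⊗ₜ[k] d) := by
  simp [ttc]

/-- `a ⊗ b ↦ (a·m)₍₋₁₎ β(b) ⊗ (a·m)₍₀₎`. -/
def preL (μ : H ⊗[k] H →ₗ[k] H) (β : H →ₗ[k] H) (ρ : H ⊗[k] M →ₗ[k] M) (lM : M →ₗ[k] H ⊗[k] M)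
    (m : M) : H ⊗[k] H →ₗ[k] H ⊗[k] M :=
  TensorProduct.map μ LinearMap.id ∘ₗ rearr k H M H ∘ₗ
    TensorProduct.map (lM ∘ₗ ρ ∘ₗ (TensorProduct.mk k H M).flip m) β

/-- `a ⊗ b ↦ β(a) γ(m₍₋₁₎) ⊗ γ(b)·m₍₀₎`. -/
def preR (μ : H ⊗[k] H →ₗ[k] H) (β γ : H →ₗ[k] H) (ρ : H ⊗[k] M →ₗ[k] M)
    (lM : M →ₗ[k] H ⊗[k] M) (m : M) : H ⊗[k] H →ₗ[k] H ⊗[k] M :=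
  TensorProduct.map (μ ∘ₗ TensorProduct.map β γ) (ρ ∘ₗ TensorProduct.map γ LinearMap.id) ∘ₗ
    ttc k H H H M ∘ₗ (TensorProduct.mk k (H ⊗[k] H) (H ⊗[k] M)).flip (lM m)

theorem preL_comul (μ : H ⊗[k] H →ₗ[k] H) (Δ : H →ₗ[k] H ⊗[k] H) (β : H →ₗ[k] H)
    (ρ : H ⊗[k] M →ₗ[k] M) (lM : M →ₗ[k] H ⊗[k] M) (h : H) (m : M) :
    preL k μ β ρ lM m (Δ h) = ydL k μ Δ β ρ lM (h ⊗ₜ[k] m) := by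
  simp only [preL, ydL, LinearMap.comp_apply, TensorProduct.map_tmul, LinearMap.id_apply]
  induction Δ h using TensorProduct.induction_on with
  | zero => simp
  | tmul a b => simp
  | add x y hx hy => simp only [map_add, TensorProduct.add_tmul, hx, hy]

theorem preR_comul (μ : H ⊗[k] H →ₗ[k] H) (Δ : H →ₗ[k] H ⊗[k] H) (β γ : H →ₗ[k] H)
    (ρ : H ⊗[k] M →ₗ[k] M) (lM : M →ₗ[k] H ⊗[k] M) (h : H) (m : M) :
    preR k μ β γ ρ lM m (Δ h) = ydR k μ Δ β γ ρ lM (h ⊗ₜ[k] m) := by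
  simp [preR, ydR]

theorem preL_comul_eq_preR_comul {μ : H ⊗[k] H →ₗ[k] H} {Δ : H →ₗ[k] H ⊗[k] H} {α : H →ₗ[k] H}
    {ρ : H ⊗[k] M →ₗ[k] M} {lM : M →ₗ[k] H ⊗[k] M} {αM : M →ₗ[k] M}
    (hM : IsYetterDrinfeld k μ Δ α ρ lM αM) (m : M) :
    preL k μ (α ∘ₗ α) ρ lM m ∘ₗ Δ = preR k μ (α ∘ₗ α) α ρ lM m ∘ₗ Δ := by
  ext h
  simp only [LinearMap.comp_apply, preL_comul, preR_comul, hM.2.2]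

variable {k}

theorem IsHomBialgebra.symm_mul {μ : H ⊗[k] H →ₗ[k] H} {Δ : H →ₗ[k] H ⊗[k] H} {α : H ≃ₗ[k] H}
    (hH : IsHomBialgebra k μ Δ α.toLinearMap) (a b : H) :
    α.symm (μ (a ⊗ₜ[k] b)) = μ (α.symm a ⊗ₜ[k] α.symm b) := by
  rw [LinearEquiv.symm_apply_eq]
  simpa using (hH.mul_mult (α.symm a) (α.symm b)).symm

theorem IsHomBialgebra.comul_apply {μ : H ⊗[k] H →ₗ[k] H} {Δ : H →ₗ[k] H ⊗[k] H}
    {α : H →ₗ[k] H} (hH : IsHomBialgebra k μ Δ α) (h : H) :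
    Δ (α h) = TensorProduct.map α α (Δ h) :=
  (LinearMap.congr_fun hH.comul_compat h).symm

theorem IsHomBialgebra.comul_symm {μ : H ⊗[k] H →ₗ[k] H} {Δ : H →ₗ[k] H ⊗[k] H} {α : H ≃ₗ[k] H}
    (hH : IsHomBialgebra k μ Δ α.toLinearMap) (h : H) :
    Δ (α.symm h) = TensorProduct.map α.symm.toLinearMap α.symm.toLinearMap (Δ h) := by
  have := hH.comul_apply (α.symm h)
  simp only [LinearEquiv.coe_coe, LinearEquiv.apply_symm_apply] at this
  rw [this, ← LinearMap.comp_apply, ← TensorProduct.map_comp]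
  simp

theorem hatAction_isHomModule {μ : H ⊗[k] H →ₗ[k] H} {Δ : H →ₗ[k] H ⊗[k] H} {α : H →ₗ[k] H}
    (hH : IsHomBialgebra k μ Δ α)
    {ρM : H ⊗[k] M →ₗ[k] M} {αM : M →ₗ[k] M} (hM : IsHomModule k μ α ρM αM)
    {ρN : H ⊗[k] N →ₗ[k] N} {αN : N →ₗ[k] N} (hN : IsHomModule k μ α ρN αN) :
    IsHomModule k μ α (hatAction k Δ ρM ρN) (TensorProduct.map αM αN) where
  str_compat h x := by
    simp only [hatAction, LinearMap.comp_apply, TensorProduct.map_tmul, LinearMap.id_apply,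
      hH.comul_apply]
    induction x using TensorProduct.induction_on with
    | zero => simp
    | add x y hx hy => simp only [map_add, TensorProduct.tmul_add, hx, hy]
    | tmul m n =>
      induction Δ h using TensorProduct.induction_on with
      | zero => simp
      | add x y hx hy => simp only [map_add, TensorProduct.add_tmul, hx, hy]
      | tmul a b => simp [hM.str_compat, hN.str_compat]
  hom_smul h h' x := by
    have hmul := LinearMap.congr_fun hH.comul_mul (h ⊗ₜ[k] h')
    simp only [LinearMap.comp_apply, TensorProduct.map_tmul] at hmul
    simp only [hatAction, LinearMap.comp_apply, TensorProduct.map_tmul, LinearMap.id_apply,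
      hH.comul_apply, hmul]
    induction x using TensorProduct.induction_on with
    | zero => simp
    | add x y hx hy => simp only [map_add, TensorProduct.tmul_add, hx, hy]
    | tmul m n =>
      induction Δ h using TensorProduct.induction_on with
      | zero => simp
      | add x y hx hy => simp only [map_add, TensorProduct.add_tmul, hx, hy]
      | tmul a b =>
        induction Δ h' using TensorProduct.induction_on with
        | zero => simp
        | add x y hx hy =>
          simp only [map_add, TensorProduct.tmul_add, TensorProduct.add_tmul, hx, hy]
        | tmul c d => simp [hM.hom_smul, hN.hom_smul]

theorem hatCoaction_isHomComodule {μ : H ⊗[k] H →ₗ[k] H} {Δ : H →ₗ[k] H ⊗[k] H} {α : H ≃ₗ[k] H}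
    (hH : IsHomBialgebra k μ Δ α.toLinearMap)
    {lM : M →ₗ[k] H ⊗[k] M} {αM : M →ₗ[k] M} (hM : IsHomComodule k Δ α.toLinearMap lM αM)
    {lN : N →ₗ[k] H ⊗[k] N} {αN : N →ₗ[k] N} (hN : IsHomComodule k Δ α.toLinearMap lN αN) :
    IsHomComodule k Δ α.toLinearMap (hatCoaction k μ α.symm.toLinearMap lM lN)
      (TensorProduct.map αM αN) where
  str_compat := by
    have mul_mult : ∀ a b : H, α (μ (a ⊗ₜ[k] b)) = μ (α a ⊗ₜ[k] α b) := hH.mul_mult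
    ext m n
    have hm := LinearMap.congr_fun hM.str_compat m
    have hn := LinearMap.congr_fun hN.str_compat n
    simp only [LinearMap.comp_apply] at hm hn
    simp only [hatCoaction, LinearMap.comp_apply, TensorProduct.map_tmul,
      TensorProduct.AlgebraTensorModule.curry_apply, TensorProduct.curry_apply,
      LinearMap.coe_restrictScalars, ← hm, ← hn]
    induction lM m using TensorProduct.induction_on with
    | zero => simp
    | add x y hx hy => simp only [map_add, TensorProduct.add_tmul, hx, hy]
    | tmul a m' =>
      induction lN n using TensorProduct.induction_on with
      | zero => simp
      | add x y hx hy => simp only [map_add, TensorProduct.tmul_add, hx, hy]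
      | tmul b n' => simp [mul_mult, hH.symm_mul]
  hom_coact := by
    have mul_mult : ∀ a b : H, α (μ (a ⊗ₜ[k] b)) = μ (α a ⊗ₜ[k] α b) := hH.mul_mult
    -- Regroup both factors: `(a ⊗ b) ⊗ m', (c ⊗ d) ⊗ n' ↦ (α⁻²(ac) ⊗ α⁻²(bd)) ⊗ (m' ⊗ n')`.
    let σ : H →ₗ[k] H := α.symm.toLinearMap ∘ₗ α.symm.toLinearMap
    let Ψ : ((H ⊗[k] H) ⊗[k] M) ⊗[k] ((H ⊗[k] H) ⊗[k] N) →ₗ[k] (H ⊗[k] H) ⊗[k] (M ⊗[k] N) :=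
      TensorProduct.map (TensorProduct.map (σ ∘ₗ μ) (σ ∘ₗ μ) ∘ₗ ttc k H H H H) LinearMap.id ∘ₗ
        ttc k (H ⊗[k] H) M (H ⊗[k] H) N
    ext m n
    have hm := LinearMap.congr_fun hM.hom_coact m
    have hn := LinearMap.congr_fun hN.hom_coact n
    simp only [LinearMap.comp_apply] at hm hn
    trans Ψ (TensorProduct.map Δ αM (lM m) ⊗ₜ[k] TensorProduct.map Δ αN (lN n))
    · simp only [hatCoaction, LinearMap.comp_apply, TensorProduct.map_tmul,
        TensorProduct.AlgebraTensorModule.curry_apply, TensorProduct.curry_apply,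
        LinearMap.coe_restrictScalars]
      induction lM m using TensorProduct.induction_on with
      | zero => simp
      | add x y hx hy => simp only [map_add, TensorProduct.add_tmul, hx, hy]
      | tmul a m' =>
        induction lN n using TensorProduct.induction_on with
        | zero => simp
        | add x y hx hy => simp only [map_add, TensorProduct.tmul_add, hx, hy]
        | tmul b n' =>
          have hmul := LinearMap.congr_fun hH.comul_mul (a ⊗ₜ[k] b)
          simp only [LinearMap.comp_apply, TensorProduct.map_tmul] at hmul
          simp only [Ψ, σ, ttc_tmul, LinearMap.comp_apply, TensorProduct.map_tmul,
            LinearEquiv.coe_coe, hH.comul_symm, hmul, LinearMap.id_apply]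
          congr 1
          generalize ttc k H H H H (Δ a ⊗ₜ[k] Δ b) = t
          induction t using TensorProduct.induction_on with
          | zero => simp
          | add x y hx hy => simp only [map_add, hx, hy]
          | tmul x y => simp
    · rw [hm, hn]
      simp only [hatCoaction, LinearMap.comp_apply, TensorProduct.map_tmul,
        TensorProduct.AlgebraTensorModule.curry_apply, TensorProduct.curry_apply,
        LinearMap.coe_restrictScalars]
      induction lM m using TensorProduct.induction_on with
      | zero => simp
      | add x y hx hy => simp only [map_add, TensorProduct.add_tmul, hx, hy]
      | tmul a m' =>
        induction lN n using TensorProduct.induction_on with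
        | zero => simp
        | add x y hx hy => simp only [map_add, TensorProduct.tmul_add, hx, hy]
        | tmul b n' =>
          simp only [ttc_tmul, TensorProduct.map_tmul, LinearMap.id_apply, LinearMap.comp_apply]
          induction lM m' using TensorProduct.induction_on with
          | zero => simp
          | add x y hx hy =>
            simp only [map_add, TensorProduct.add_tmul, TensorProduct.tmul_add, hx, hy]
          | tmul c m'' =>
            induction lN n' using TensorProduct.induction_on with
            | zero => simp
            | add x y hx hy => simp only [map_add, TensorProduct.tmul_add, hx, hy]
            | tmul d n'' => simp [Ψ, σ, mul_mult, hH.symm_mul]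

theorem hatAction_hatCoaction_compat {μ : H ⊗[k] H →ₗ[k] H} {Δ : H →ₗ[k] H ⊗[k] H}
    {α : H ≃ₗ[k] H} (hH : IsHomBialgebra k μ Δ α.toLinearMap)
    {ρM : H ⊗[k] M →ₗ[k] M} {lM : M →ₗ[k] H ⊗[k] M} {αM : M →ₗ[k] M}
    (hM : IsYetterDrinfeld k μ Δ α.toLinearMap ρM lM αM)
    {ρN : H ⊗[k] N →ₗ[k] N} {lN : N →ₗ[k] H ⊗[k] N} {αN : N →ₗ[k] N}
    (hN : IsYetterDrinfeld k μ Δ α.toLinearMap ρN lN αN) :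
    ydL k μ Δ (α.toLinearMap ∘ₗ α.toLinearMap) (hatAction k Δ ρM ρN)
        (hatCoaction k μ α.symm.toLinearMap lM lN) =
      ydR k μ Δ (α.toLinearMap ∘ₗ α.toLinearMap) α.toLinearMap (hatAction k Δ ρM ρN)
        (hatCoaction k μ α.symm.toLinearMap lM lN) := by
  have mul_mult : ∀ a b : H, α (μ (a ⊗ₜ[k] b)) = μ (α a ⊗ₜ[k] α b) := hH.mul_mult
  have hom_assoc : ∀ a b c : H, μ (α a ⊗ₜ[k] μ (b ⊗ₜ[k] c)) = μ (μ (a ⊗ₜ[k] b) ⊗ₜ[k] α c) :=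
    hH.hom_assoc
  let σ : H →ₗ[k] H := α.symm.toLinearMap ∘ₗ α.symm.toLinearMap
  let α₂ : H →ₗ[k] H := α.toLinearMap ∘ₗ α.toLinearMap
  -- `(x ⊗ m') ⊗ (y ⊗ n') ↦ α⁻²(α(x) y) ⊗ (m' ⊗ n')`
  let Q : (H ⊗[k] M) ⊗[k] (H ⊗[k] N) →ₗ[k] H ⊗[k] (M ⊗[k] N) :=
    TensorProduct.map (σ ∘ₗ μ ∘ₗ TensorProduct.map α.toLinearMap LinearMap.id) LinearMap.id ∘ₗ
      ttc k H M H N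
  -- `(x ⊗ m') ⊗ (y ⊗ n') ↦ α⁻²(x α²(y)) ⊗ (m' ⊗ n')`
  let Q' : (H ⊗[k] M) ⊗[k] (H ⊗[k] N) →ₗ[k] H ⊗[k] (M ⊗[k] N) :=
    TensorProduct.map (σ ∘ₗ μ ∘ₗ TensorProduct.map LinearMap.id α₂) LinearMap.id ∘ₗ
      ttc k H M H N
  ext h m n
  simp only [TensorProduct.AlgebraTensorModule.curry_apply, TensorProduct.curry_apply,
      LinearMap.coe_restrictScalars]
  let S : H →ₗ[k] H ⊗[k] M := lM ∘ₗ ρM ∘ₗ (TensorProduct.mk k H M).flip m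
  -- `c ↦ n₍₋₁₎ ⊗ α(c)·n₍₀₎`
  let W : H →ₗ[k] H ⊗[k] N :=
    TensorProduct.map LinearMap.id (ρN ∘ₗ (TensorProduct.comm k N H).toLinearMap) ∘ₗ
      (TensorProduct.assoc k H N H).toLinearMap ∘ₗ
        TensorProduct.mk k (H ⊗[k] N) H (lN n) ∘ₗ α.toLinearMap
  have coassoc := LinearMap.congr_fun hH.hom_coassoc h
  simp only [LinearMap.comp_apply, LinearEquiv.coe_coe] at coassoc
  have hLm : preL k μ α₂ ρM lM m ∘ₗ Δ = preR k μ α₂ α.toLinearMap ρM lM m ∘ₗ Δ :=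
    preL_comul_eq_preR_comul k hM m
  have hLn : preL k μ α₂ ρN lN n ∘ₗ Δ = preR k μ α₂ α.toLinearMap ρN lN n ∘ₗ Δ :=
    preL_comul_eq_preR_comul k hN n
  calc _ = Q (TensorProduct.map S (preL k μ α₂ ρN lN n)
          (TensorProduct.assoc k H H H (TensorProduct.map Δ α.toLinearMap (Δ h)))) := by
        simp only [ydL, hatAction, LinearMap.comp_apply, TensorProduct.map_tmul, LinearMap.id_apply]
        induction Δ h using TensorProduct.induction_on with
        | zero => simp
        | add x y hx hy => simp only [map_add, TensorProduct.add_tmul, hx, hy]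
        | tmul h₁ h₂ =>
          simp only [rearr_tmul, TensorProduct.map_tmul, LinearMap.comp_apply, LinearMap.id_apply]
          induction Δ h₁ using TensorProduct.induction_on with
          | zero => simp
          | add x y hx hy => simp only [map_add, TensorProduct.add_tmul, hx, hy]
          | tmul a b =>
            simp only [ttc_tmul, TensorProduct.map_tmul, TensorProduct.assoc_tmul, S, preL,
              hatCoaction, LinearMap.comp_apply, LinearMap.flip_apply, TensorProduct.mk_apply]
            induction lM (ρM (a ⊗ₜ[k] m)) using TensorProduct.induction_on with
            | zero => simp
            | add x y hx hy => simp only [map_add, TensorProduct.add_tmul, hx, hy]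
            | tmul x m' =>
              induction lN (ρN (b ⊗ₜ[k] n)) using TensorProduct.induction_on with
              | zero => simp
              | add x y hx hy =>
                simp only [map_add, TensorProduct.tmul_add, TensorProduct.add_tmul, hx, hy]
              | tmul y n' => simp [Q, σ, α₂, hom_assoc, hH.symm_mul]
    _ = Q (TensorProduct.map S (preR k μ α₂ α.toLinearMap ρN lN n)
          (TensorProduct.assoc k H H H (TensorProduct.map Δ α.toLinearMap (Δ h)))) := by
        rw [coassoc, TensorProduct.map_map, TensorProduct.map_map, hLn]
    _ = Q' (TensorProduct.map (preL k μ α₂ ρM lM m) W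
          (TensorProduct.map Δ α.toLinearMap (Δ h))) := by
        generalize TensorProduct.map Δ α.toLinearMap (Δ h) = t
        induction t using TensorProduct.induction_on with
        | zero => simp
        | add x y hx hy => simp only [map_add, hx, hy]
        | tmul t c =>
          induction t using TensorProduct.induction_on with
          | zero => simp
          | add x y hx hy => simp only [map_add, TensorProduct.add_tmul, hx, hy]
          | tmul a b =>
            simp only [TensorProduct.map_tmul, TensorProduct.assoc_tmul, S, W, preL, preR,
              LinearMap.comp_apply, LinearMap.flip_apply, TensorProduct.mk_apply]
            induction lM (ρM (a ⊗ₜ[k] m)) using TensorProduct.induction_on with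
            | zero => simp
            | add x y hx hy => simp only [map_add, TensorProduct.add_tmul, hx, hy]
            | tmul x m' =>
              induction lN n using TensorProduct.induction_on with
              | zero => simp
              | add x y hx hy =>
                simp only [map_add, TensorProduct.tmul_add, TensorProduct.add_tmul, hx, hy]
              | tmul y n' => simp [Q, Q', σ, α₂, hom_assoc]
    _ = Q' (TensorProduct.map (preR k μ α₂ α.toLinearMap ρM lM m) W
          (TensorProduct.map Δ α.toLinearMap (Δ h))) := by
        rw [TensorProduct.map_map, TensorProduct.map_map, hLm]
    _ = Q' (TensorProduct.map (preR k μ α₂ α.toLinearMap ρM lM m) W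
          ((TensorProduct.assoc k H H H).symm (TensorProduct.map α.toLinearMap Δ (Δ h)))) := by
        rw [← coassoc, LinearEquiv.symm_apply_apply]
    _ = _ := by
        simp only [ydR, TensorProduct.map_tmul, LinearMap.comp_apply, hatCoaction]
        induction Δ h using TensorProduct.induction_on with
        | zero => simp
        | add x y hx hy => simp only [map_add, TensorProduct.add_tmul, hx, hy]
        | tmul h₁ h₂ =>
          simp only [W, preR, TensorProduct.map_tmul]
          induction lM m using TensorProduct.induction_on with
          | zero => simp
          | add x y hx hy =>
            simp only [map_add, LinearMap.comp_add, TensorProduct.map_add_left,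
              LinearMap.add_apply, TensorProduct.tmul_add, TensorProduct.add_tmul, hx, hy]
          | tmul x m' =>
            induction lN n using TensorProduct.induction_on with
            | zero => simp
            | add x y hx hy =>
              simp only [map_add, LinearMap.comp_add, LinearMap.add_comp,
                TensorProduct.map_add_right, LinearMap.add_apply, TensorProduct.tmul_add, hx, hy]
            | tmul y n' =>
              simp only [ttc_tmul, TensorProduct.map_tmul, hatAction, LinearMap.comp_apply,
                LinearMap.id_apply, hH.comul_apply]
              induction Δ h₂ using TensorProduct.induction_on with
              | zero => simp
              | add x y hx hy =>
                simp only [map_add, TensorProduct.tmul_add, TensorProduct.add_tmul, hx, hy]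
              | tmul b c => simp [Q', σ, α₂, hom_assoc, mul_mult, hH.symm_mul]

/-- the tensor product `M ⊗̂ N` of two Yetter-Drinfeld modules, with action
`h·(m⊗n) = h₁·m ⊗ h₂·n` and coaction `m⊗n ↦ αH⁻²(m₍₋₁₎n₍₋₁₎) ⊗ (m₍₀₎ ⊗ n₍₀₎)`,
is again a Yetter-Drinfeld module. -/
theorem stmt3 {k H M N : Type*} [Field k]
    [AddCommGroup H] [Module k H] [AddCommGroup M] [Module k M] [AddCommGroup N] [Module k N]
    (μ : H ⊗[k] H →ₗ[k] H) (Δ : H →ₗ[k] H ⊗[k] H) (αH : H ≃ₗ[k] H)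
    (hH : IsHomBialgebra k μ Δ αH.toLinearMap)
    (ρM : H ⊗[k] M →ₗ[k] M) (lM : M →ₗ[k] H ⊗[k] M) (αM : M →ₗ[k] M)
    (hM : IsYetterDrinfeld k μ Δ αH.toLinearMap ρM lM αM)
    (ρN : H ⊗[k] N →ₗ[k] N) (lN : N →ₗ[k] H ⊗[k] N) (αN : N →ₗ[k] N)
    (hN : IsYetterDrinfeld k μ Δ αH.toLinearMap ρN lN αN) :
    IsYetterDrinfeld k μ Δ αH.toLinearMap (hatAction k Δ ρM ρN)
      (hatCoaction k μ αH.symm.toLinearMap lM lN) (TensorProduct.map αM αN) := by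
  exact ⟨hatAction_isHomModule hH hM.1 hN.1, hatCoaction_isHomComodule hH hM.2.1 hN.2.1,
    hatAction_hatCoaction_compat hH hM hN⟩

end HomYD
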